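/- Let G be a group acting on a set X, and suppose there exist elements g₁ ≠ 1 and g₂ ≠ 1 of G whose supports supp(g₁) = {x | g₁ • x ≠ x} and supp(g₂) = {x | g₂ • x ≠ x} are disjoint. Then the ℂ-algebra homomorphism from the group algebra MonoidAlgebra ℂ G to the ℂ-linear endomorphisms of X →₀ ℂ induced by the permutation representation is not injective: the element g₁g₂ - g₁ - g₂ + 1 of MonoidAlgebra ℂ G is nonzero but lies in its kernel. -/

import Mathlib

/-- If `g₁` and `g₂` have disjoint supports, then the permutation operators satisfy
`ρ (g₁ * g₂) + 1 = ρ g₁ + ρ g₂`. -/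
theorem Representation.ofMulAction_mul_add_one_of_disjoint (k : Type*) {G X : Type*}
    [CommSemiring k] [Group G] [MulAction G X] {g₁ g₂ : G}
    (h : Disjoint {x : X | g₁ • x ≠ x} {x : X | g₂ • x ≠ x}) :
    Representation.ofMulAction k G X (g₁ * g₂) + 1 =
      Representation.ofMulAction k G X g₁ + Representation.ofMulAction k G X g₂ := by
  have key (x : X) : g₂ • x = x ∨ (g₁ • x = x ∧ g₁ • g₂ • x = g₂ • x) := by
    by_cases hx : g₂ • x = x
    · exact Or.inl hx
    · have fixed {y : X} (hy : g₂ • y ≠ y) : g₁ • y = y :=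
        not_not.mp fun hy' => Set.disjoint_left.mp h hy' hy
      exact Or.inr ⟨fixed hx, fixed fun hy => hx (MulAction.injective g₂ hy)⟩
  ext x : 2
  simp only [LinearMap.comp_apply, LinearMap.add_apply, MonoidAlgebra.lsingle_apply,
    Representation.ofMulAction_single, Module.End.one_apply, mul_smul]
  rcases key x with hx | ⟨hx, hx'⟩
  · rw [hx]
  · rw [hx, hx', add_comm]

/-- The element `g₁g₂ - g₁ - g₂ + 1` of a group algebra has nonzero coefficient at `1`. -/
theorem MonoidAlgebra.of_mul_sub_of_sub_of_add_one_ne_zero (k : Type*) {G : Type*}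
    [Ring k] [CharZero k] [Monoid G] {g₁ g₂ : G} (h₁ : g₁ ≠ 1) (h₂ : g₂ ≠ 1) :
    MonoidAlgebra.of k G (g₁ * g₂) - MonoidAlgebra.of k G g₁ - MonoidAlgebra.of k G g₂ + 1
      ≠ 0 := by
  classical
  intro h
  have hc := congrArg (fun a => a.coeff 1) h
  simp only [MonoidAlgebra.of_apply, MonoidAlgebra.one_def, MonoidAlgebra.coeff_add,
    MonoidAlgebra.coeff_sub, MonoidAlgebra.coeff_single, MonoidAlgebra.coeff_zero,
    Finsupp.add_apply, Finsupp.sub_apply, Finsupp.single_apply, Finsupp.zero_apply,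
    h₁, h₂, if_true, if_false, sub_zero] at hc
  split_ifs at hc
  · norm_num at hc
  · simp at hc

/-- If `g₁ ≠ 1` and `g₂ ≠ 1` have disjoint supports for an action of `G`
on `X`, then the algebra homomorphism `MonoidAlgebra ℂ G → Module.End ℂ (X →₀ ℂ)` induced
by the permutation representation is not injective: the element `g₁g₂ - g₁ - g₂ + 1` of the
group algebra is nonzero but lies in its kernel. -/
theorem permRep_asAlgebraHom_not_injective {G X : Type*} [Group G] [MulAction G X]
    (g₁ g₂ : G) (h₁ : g₁ ≠ 1) (h₂ : g₂ ≠ 1)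
    (hdisj : Disjoint {x : X | g₁ • x ≠ x} {x : X | g₂ • x ≠ x}) :
    ¬ Function.Injective ⇑(Representation.ofMulAction ℂ G X).asAlgebraHom ∧
    (MonoidAlgebra.of ℂ G (g₁ * g₂) - MonoidAlgebra.of ℂ G g₁ - MonoidAlgebra.of ℂ G g₂ + 1
        ≠ 0) ∧
    (Representation.ofMulAction ℂ G X).asAlgebraHom
        (MonoidAlgebra.of ℂ G (g₁ * g₂) - MonoidAlgebra.of ℂ G g₁ - MonoidAlgebra.of ℂ G g₂ + 1)
      = 0 := by
  have hne := MonoidAlgebra.of_mul_sub_of_sub_of_add_one_ne_zero ℂ h₁ h₂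
  have hker : (Representation.ofMulAction ℂ G X).asAlgebraHom
      (MonoidAlgebra.of ℂ G (g₁ * g₂) - MonoidAlgebra.of ℂ G g₁ - MonoidAlgebra.of ℂ G g₂ + 1)
        = 0 := by
    simp only [map_add, map_sub, map_one, Representation.asAlgebraHom_of]
    rw [sub_sub, sub_add_eq_add_sub,
      Representation.ofMulAction_mul_add_one_of_disjoint ℂ hdisj, sub_self]
  exact ⟨fun hinj => hne (hinj (hker.trans (map_zero _).symm)), hne, hker⟩
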